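/- arXiv:2412.04250 — 2 statements merged into one kernel-verified Lean document; each statement's English description precedes it below -/
import Mathlib

section
/- Let G = G₁ * ⋯ * Gₙ be a free product and suppose H₁, ..., Hₙ are subgroups of G such that each Hᵢ is conjugate to Gᵢ (say Hᵢ = gᵢ⁻¹ Gᵢ gᵢ) and H₁, ..., Hₙ together generate G. Then there exists an automorphism ψ of G with ψ(Gᵢ) = Hᵢ for each i, and moreover ψ restricts on each Gᵢ to conjugation by gᵢ. -/
/-- `H : ι → Subgroup G` is an (internal) free product decomposition of `G`:
the canonical map from the external free product of the `H i` to `G` is bijective. -/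
def IsFreeProductOf {ι : Type*} {G : Type*} [Group G] (H : ι → Subgroup G) : Prop :=
  Function.Bijective (Monoid.CoprodI.lift fun i => (H i).subtype)

namespace FPConj

open Monoid Monoid.CoprodI

set_option linter.unusedSectionVars false

variable {ι : Type*} {M : ι → Type*} [∀ i, Group (M i)] [DecidableEq ι] [∀ i, DecidableEq (M i)]

/-- Normal form of an element. -/
def N (x : CoprodI M) : Word M := Word.equiv x

theorem N_prod (w : Word M) : N w.prod = w := Word.equiv.apply_symm_apply w

theorem prod_N (x : CoprodI M) : (N x).prod = x := Word.equiv.symm_apply_apply x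

/-- Product of a list of syllables. -/
def lprod (L : List (Σ i, M i)) : CoprodI M := (L.map fun l => of l.snd).prod

theorem lprod_N (x : CoprodI M) : lprod (N x).toList = x := prod_N x

theorem lprod_append (L L' : List (Σ i, M i)) : lprod (L ++ L') = lprod L * lprod L' := by
  simp [lprod]

/-- Syllable length. -/
def len (x : CoprodI M) : ℕ := (N x).toList.length

theorem rcons_len {i : ι} (p : Word.Pair M i) :
    p.tail.toList.length ≤ (Word.rcons p).toList.length ∧
    (Word.rcons p).toList.length ≤ p.tail.toList.length + 1 := by
  unfold Word.rcons
  split_ifs <;> simp [Word.cons]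

theorem len_of_mul {i : ι} (m : M i) (x : CoprodI M) : len (of m * x) ≤ len x + 1 := by
  have h : N (of m * x) = of m • N x := by
    conv_lhs => rw [← prod_N x, ← Word.prod_smul, N_prod]
  unfold len
  rw [h, Word.of_smul_def]
  refine (rcons_len _).2.trans ?_
  have h2 := (rcons_len (Word.equivPair i (N x))).1
  rw [← Word.equivPair_symm, Equiv.symm_apply_apply] at h2
  simpa using h2

theorem len_lprod (L : List (Σ i, M i)) : len (lprod L) ≤ L.length := by
  induction L with
  | nil =>
    have : N (1 : CoprodI M) = Word.empty := by rw [← Word.prod_empty, N_prod]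
    simp [lprod, len, this, Word.empty]
  | cons a L ih =>
    have := len_of_mul a.2 (lprod L)
    have e : lprod (a :: L) = of a.2 * lprod L := by simp [lprod]
    rw [e, List.length_cons]
    omega

/-- The endomorphism conjugating the `i`th factor by `k i`. -/
def phi (k : ι → CoprodI M) : CoprodI M →* CoprodI M :=
  lift fun i => (MulAut.conj (k i)).toMonoidHom.comp of

theorem phi_of (k : ι → CoprodI M) {i : ι} (m : M i) :
    phi k (of m) = k i * of m * (k i)⁻¹ := by
  simp [phi]

/-- Elementary move. -/
theorem move (k : ι → CoprodI M) (j i : ι) (b : M i)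
    (h : Function.Injective (phi (Function.update k j (phi k (of b) * k j)))) :
    Function.Injective (phi k) := by
  let α : M i → CoprodI M →* CoprodI M := fun c => phi (Function.update 1 j (of c))
  have hα : ∀ c, (α c).comp (α c⁻¹) = MonoidHom.id _ := by
    intro c
    refine ext_hom _ _ fun l => ?_
    ext m
    simp only [MonoidHom.comp_apply, α, MonoidHom.id_apply]
    by_cases hl : l = j
    · subst hl
      by_cases hi : i = l
      · subst hi
        simp [phi_of, mul_assoc]
      · simp [phi_of, mul_assoc, Function.update_of_ne hi]
    · simp [phi_of, Function.update_of_ne hl]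
  have hc : phi (Function.update k j (phi k (of b) * k j)) = (phi k).comp (α b) := by
    refine ext_hom _ _ fun l => ?_
    ext m
    simp only [MonoidHom.comp_apply, α]
    by_cases hl : l = j
    · subst hl
      simp [phi_of, mul_assoc]
    · simp [phi_of, Function.update_of_ne hl]
  have hk : phi k = (phi (Function.update k j (phi k (of b) * k j))).comp (α b⁻¹) := by
    rw [hc, MonoidHom.comp_assoc, hα, MonoidHom.comp_id]
  rw [hk, MonoidHom.coe_comp]
  refine h.comp ?_
  have h3 := hα b⁻¹
  rw [inv_inv] at h3
  have h4 := hα b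
  exact Function.LeftInverse.injective (g := α b) fun x => by
    simpa using DFunLike.congr_fun h4 x

/-- Ping-pong sets. -/
def X (k : ι → CoprodI M) (i : ι) (u : CoprodI M) : Prop :=
  (N ((k i)⁻¹ * u)).fstIdx = some i

theorem X_step (k : ι → CoprodI M) (i : ι) (u : CoprodI M) (hu : ¬ X k i u) (m : M i)
    (hm : m ≠ 1) : X k i (phi k (of m) * u) := by
  unfold X at *
  have : (k i)⁻¹ * (phi k (of m) * u) = (Word.cons m (N ((k i)⁻¹ * u)) hu hm).prod := by
    rw [Word.prod_cons, prod_N, phi_of]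
    group
  rw [this, N_prod, Word.fstIdx_cons]

theorem X_normal_form (k : ι → CoprodI M) (i : ι) (u : CoprodI M) (hu : X k i u)
    (hk : ∀ (L : List (Σ i, M i)) (x : M i), (N (k i)).toList ≠ L ++ [⟨i, x⟩]) :
    ∃ x : M i, (N (k i)).toList ++ [⟨i, x⟩] <+: (N u).toList := by
  set v := N ((k i)⁻¹ * u) with hv
  have hf : v.fstIdx = some i := hu
  obtain ⟨⟨l, x⟩, hx, hl⟩ := Option.map_eq_some_iff.1 hf
  obtain rfl : l = i := hl
  obtain ⟨R, hR⟩ : ∃ R, v.toList = ⟨l, x⟩ :: R := by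
    cases h : v.toList with
    | nil => simp [h] at hx
    | cons a R => 
      simp [h] at hx
      exact ⟨R, by rw [hx]⟩
  let w : Word M :=
    { toList := (N (k l)).toList ++ v.toList
      ne_one := by
        intro a ha
        rcases List.mem_append.1 ha with h | h
        · exact (N (k l)).ne_one a h
        · exact v.ne_one a h
      chain_ne := by
        refine List.isChain_append.2 ⟨(N (k l)).chain_ne, v.chain_ne, ?_⟩
        rintro ⟨p, y⟩ ha b hb hab
        rw [hR] at hb
        simp at hb
        subst hb
        obtain rfl : p = l := hab
        obtain ⟨L, hL⟩ := List.getLast?_eq_some_iff.1 (Option.mem_def.1 ha)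
        exact hk L y hL }
  have hw : N u = w := by
    have : w.prod = u := by
      change lprod ((N (k l)).toList ++ v.toList) = u
      rw [lprod_append, lprod_N, hv, lprod_N]
      group
    rw [← this, N_prod]
  refine ⟨x, R, ?_⟩
  rw [hw]
  simp [w, hR]

theorem phi_injective_of_disjoint (k : ι → CoprodI M) (h1 : ∀ i, ¬ X k i 1)
    (hd : ∀ i j u, X k i u → X k j u → i = j) : Function.Injective (phi k) := by
  have key : ∀ w : Word M, ∀ i, w.fstIdx ≠ some i → ¬ X k i (phi k w.prod) := by
    intro w
    induction w using Word.consRecOn with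
    | empty => intro i _; simpa using h1 i
    | cons j m w h h' ih =>
      intro i hi hX
      rw [Word.prod_cons, map_mul] at hX
      have := hd _ _ _ hX (X_step k j _ (ih j h) m h')
      subst this
      simp at hi
  rw [injective_iff_map_eq_one]
  intro x hx
  rw [← prod_N x] at hx ⊢
  generalize N x = w at hx
  induction w using Word.consRecOn with
  | empty => simp
  | cons j m w h h' _ =>
    exfalso
    have := X_step k j _ (key w j h) m h'
    rw [← map_mul, ← Word.prod_cons _ _ _ h' h, hx] at this
    exact h1 _ this

theorem phi_injective [Fintype ι] (k : ι → CoprodI M) : Function.Injective (phi k) := by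
  induction hm : ∑ i, len (k i) using Nat.strong_induction_on generalizing k with
  | _ s ih =>
  have red : ∀ j i (b : M i), len (phi k (of b) * k j) < len (k j) →
      Function.Injective (phi k) := by
    intro j i b hlt
    refine move k j i b (ih _ ?_ _ rfl)
    rw [← hm]
    refine Finset.sum_lt_sum (fun l _ => ?_) ⟨j, Finset.mem_univ _, by simpa using hlt⟩
    by_cases hl : l = j
    · subst hl; simpa using hlt.le
    · simp [Function.update_of_ne hl]
  by_cases hA : ∃ i, ∃ (L : List (Σ i, M i)) (x : M i), (N (k i)).toList = L ++ [⟨i, x⟩]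
  · obtain ⟨i, L, x, h⟩ := hA
    refine red i i x⁻¹ ?_
    have e : k i = lprod L * of x := by
      rw [← lprod_N (k i), h, lprod_append]; simp [lprod]
    have : phi k (of x⁻¹) * k i = lprod L := by
      rw [phi_of, inv_mul_cancel_right, e, map_inv]; group
    rw [this]
    have := len_lprod L
    have h2 : len (k i) = L.length + 1 := by simp [len, h]
    omega
  push Not at hA
  by_cases hB : ∃ i j, ∃ x : M i, (N (k i)).toList ++ [⟨i, x⟩] <+: (N (k j)).toList
  · obtain ⟨i, j, x, R, h⟩ := hB
    refine red j i x⁻¹ ?_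
    have e : k j = k i * of x * lprod R := by
      rw [← lprod_N (k j), ← h, lprod_append, lprod_append, lprod_N]; simp [lprod]
    have : phi k (of x⁻¹) * k j = lprod ((N (k i)).toList ++ R) := by
      rw [phi_of, e, lprod_append, lprod_N, map_inv]; group
    rw [this]
    have := len_lprod ((N (k i)).toList ++ R)
    have h2 : len (k j) = (N (k i)).toList.length + 1 + R.length := by
      simp only [len, ← h]; simp; ring
    rw [List.length_append] at this
    omega
  push Not at hB
  refine phi_injective_of_disjoint k ?_ ?_
  · intro i hi
    obtain ⟨x, hx⟩ := X_normal_form k i 1 hi (hA i)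
    have : N (1 : CoprodI M) = Word.empty := by rw [← Word.prod_empty, N_prod]
    rw [this] at hx
    simp [Word.empty] at hx
  · intro i j u hi hj
    obtain ⟨x, hx⟩ := X_normal_form k i u hi (hA i)
    obtain ⟨y, hy⟩ := X_normal_form k j u hj (hA j)
    rcases lt_trichotomy (N (k i)).toList.length (N (k j)).toList.length with h | h | h
    · exact absurd (List.prefix_of_prefix_length_le hx ((List.prefix_append _ _).trans hy)
        (by simpa using h)) (hB i j x)
    · have h5 := (List.prefix_of_prefix_length_le hx hy (by simp [h])).eq_of_length (by simp [h])
      have := (List.append_inj h5 h).2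
      simp at this
      exact this.1
    · exact absurd (List.prefix_of_prefix_length_le hy ((List.prefix_append _ _).trans hx)
        (by simpa using h)) (hB j i y)

end FPConj

/-- if each `K i` is the conjugate `gᵢ⁻¹ (H i) gᵢ` of the free factor `H i`,
and the `K i` together generate `G`, then there is an automorphism `ψ` of `G` with
`ψ (H i) = K i` for all `i`, restricting on each `H i` to conjugation by `gᵢ`. -/
theorem stmt_0 {n : ℕ} {G : Type*} [Group G] (H : Fin n → Subgroup G)
    (hfp : IsFreeProductOf H) (g : Fin n → G) (K : Fin n → Subgroup G)
    (hK : ∀ i, ∀ x : G, x ∈ K i ↔ ∃ y ∈ H i, x = (g i)⁻¹ * y * (g i))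
    (hgen : (⨆ i, K i) = ⊤) :
    ∃ ψ : MulAut G,
      (∀ i, (H i).map (MulEquiv.toMonoidHom ψ) = K i) ∧
      ∀ i, ∀ x ∈ H i, ψ x = (g i)⁻¹ * x * (g i) := by
  classical
  let e : Monoid.CoprodI (fun i => H i) ≃* G := MulEquiv.ofBijective _ hfp
  let o : ∀ i, H i →* Monoid.CoprodI (fun i => H i) :=
    fun i => Monoid.CoprodI.of (M := fun i => H i) (i := i)
  have he : ∀ i (x : H i), e (o i x) = x := fun i x =>
    Monoid.CoprodI.lift_of (M := fun i => H i) (fun i => (H i).subtype) x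
  let k : Fin n → Monoid.CoprodI (fun i => H i) := fun i => e.symm (g i)⁻¹
  let f : G →* G := e.toMonoidHom.comp ((FPConj.phi k).comp e.symm.toMonoidHom)
  have hf : ∀ i, ∀ x ∈ H i, f x = (g i)⁻¹ * x * g i := by
    intro i x hx
    have h1 : e.symm x = o i ⟨x, hx⟩ := by
      rw [MulEquiv.symm_apply_eq, he]
    have h2 : FPConj.phi k (o i ⟨x, hx⟩) = k i * o i ⟨x, hx⟩ * (k i)⁻¹ := FPConj.phi_of k _
    change e (FPConj.phi k (e.symm x)) = _
    rw [h1, h2, map_mul, map_mul, map_inv, he]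
    simp [k]
  have hmap : ∀ i, (H i).map f = K i := by
    intro i
    ext x
    rw [hK, Subgroup.mem_map]
    constructor
    · rintro ⟨y, hy, rfl⟩
      exact ⟨y, hy, hf i y hy⟩
    · rintro ⟨y, hy, rfl⟩
      exact ⟨y, hy, hf i y hy⟩
  have hinj : Function.Injective f :=
    e.injective.comp ((FPConj.phi_injective k).comp e.symm.injective)
  have hsurj : Function.Surjective f := by
    rw [← MonoidHom.range_eq_top, eq_top_iff, ← hgen]
    refine iSup_le fun i => ?_
    rw [← hmap i]
    exact Subgroup.map_le_range _ _
  exact ⟨MulEquiv.ofBijective f ⟨hinj, hsurj⟩, fun i => hmap i, fun i x hx => hf i x hx⟩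
end

section
/- Let G = G₁ * G₂ * G₃ be a free product of three nontrivial groups, let Φ ≅ Aut(G₁) × Aut(G₂) × Aut(G₃) be the group of (outer classes of) factor automorphisms, and for each i let G_{i_j} ≤ Out(G; G₁, G₂, G₃) be the image of Gᵢ under g ↦ [({Gⱼ}, g⁻¹)]. Then the group Out(G; G₁, G₂, G₃) of pure symmetric outer automorphisms is isomorphic to (G_{1_2} * G_{2_3} * G_{3_1}) ⋊ Φ ≅ G ⋊ Φ, where Φ acts on each G_{i_j} ≅ Gᵢ through its Aut(Gᵢ)-component. -/
/-- `ψ` is a pure symmetric automorphism of the splitting: it sends each factor `H i`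
to a conjugate of itself. -/
def IsPureSymmetric {ι : Type*} {G : Type*} [Group G] (H : ι → Subgroup G)
    (ψ : MulAut G) : Prop :=
  ∀ i, ∃ g : G, (H i).map (MulEquiv.toMonoidHom ψ) =
    (H i).map (MulEquiv.toMonoidHom (MulAut.conj g))

namespace PureSym

section Words

variable {ι : Type*} {G : Type*} [Group G] (H : ι → Subgroup G)

/-- `NW H i j n g`: `g` is a product of a reduced word of length `n ≥ 1`, whose first
letter lies in `H i` and whose last letter lies in `H j`. -/
inductive NW : ι → ι → ℕ → G → Prop
  | single {i : ι} {x : G} (hx : x ∈ H i) (h1 : x ≠ 1) : NW i i 1 x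
  | cons {i k j : ι} {n : ℕ} {x g : G} (hx : x ∈ H i) (h1 : x ≠ 1) (hik : i ≠ k)
      (hg : NW k j n g) : NW i j (n + 1) (x * g)

variable {H}

theorem NW.append {i j k l : ι} {m n : ℕ} {g h : G} (hg : NW H i j m g) (hjk : j ≠ k)
    (hh : NW H k l n h) : NW H i l (m + n) (g * h) := by
  induction hg with
  | single hx h1 => rw [add_comm]; exact NW.cons hx h1 hjk hh
  | cons hx h1 hik hg ih =>
    rw [mul_assoc, add_right_comm]
    exact NW.cons hx h1 hik (ih hjk)

theorem NW.inv {i j : ι} {n : ℕ} {g : G} (hg : NW H i j n g) : NW H j i n g⁻¹ := by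
  induction hg with
  | single hx h1 => exact NW.single (inv_mem hx) (by simpa using h1)
  | cons hx h1 hik hg ih =>
    rw [mul_inv_rev]
    exact ih.append hik.symm (NW.single (inv_mem hx) (by simpa using h1))

theorem NW.pos {i j : ι} {n : ℕ} {g : G} (hg : NW H i j n g) : 1 ≤ n := by
  cases hg <;> omega

theorem NW.of_one {i j : ι} {n : ℕ} {g : G} (hg : NW H i j n g) (hn : n ≤ 1) :
    i = j ∧ g ∈ H i ∧ n = 1 := by
  cases hg with
  | single hx h1 => exact ⟨rfl, hx, rfl⟩
  | cons hx h1 hik hg => have := hg.pos; omega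

theorem NW.head {i j : ι} {n : ℕ} {g : G} (hg : NW H i j n g) :
    ∃ x g', x ∈ H i ∧ x ≠ 1 ∧ g = x * g' ∧
      ((g' = 1 ∧ n = 1 ∧ i = j) ∨ ∃ k m, k ≠ i ∧ n = m + 1 ∧ NW H k j m g') := by
  cases hg with
  | single hx h1 => exact ⟨g, 1, hx, h1, by simp, Or.inl ⟨rfl, rfl, rfl⟩⟩
  | cons hx h1 hik hg => exact ⟨_, _, hx, h1, rfl, Or.inr ⟨_, _, hik.symm, rfl, hg⟩⟩

theorem NW.last {i j : ι} {n : ℕ} {g : G} (hg : NW H i j n g) :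
    ∃ x g', x ∈ H j ∧ x ≠ 1 ∧ g = g' * x ∧
      ((g' = 1 ∧ n = 1 ∧ i = j) ∨ ∃ k m, k ≠ j ∧ n = m + 1 ∧ NW H i k m g') := by
  obtain ⟨x, g', hx, h1, he, h⟩ := hg.inv.head
  refine ⟨x⁻¹, g'⁻¹, inv_mem hx, by simpa using h1, by rw [← mul_inv_rev, ← he, inv_inv], ?_⟩
  rcases h with ⟨h, h', h''⟩ | ⟨k, m, hk, hn, h⟩
  · exact Or.inl ⟨by simpa using h, h', h''.symm⟩
  · exact Or.inr ⟨k, m, hk, hn, h.inv⟩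

theorem NW.exists_word {i j : ι} {n : ℕ} {g : G} (hg : NW H i j n g) :
    ∃ w : Monoid.CoprodI.Word (fun i => H i), w.fstIdx = some i ∧ w.toList.length = n ∧
      Monoid.CoprodI.lift (fun i => (H i).subtype) w.prod = g := by
  induction hg with
  | @single i x hx h1 =>
    refine ⟨Monoid.CoprodI.Word.cons (⟨x, hx⟩ : H i) .empty (by simp [Monoid.CoprodI.Word.fstIdx])
      (by simpa [Subtype.ext_iff] using h1), by simp, by simp, by simp⟩
  | @cons i k j n x g hx h1 hik hg ih =>
    obtain ⟨w, hw1, hw2, hw3⟩ := ih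
    refine ⟨Monoid.CoprodI.Word.cons (⟨x, hx⟩ : H i) w (by simp [hw1, hik.symm])
      (by simpa [Subtype.ext_iff] using h1), by simp, by simp [hw2], by simp [hw3]⟩

theorem word_inj (hfp : IsFreeProductOf H) {w w' : Monoid.CoprodI.Word (fun i => H i)}
    (h : Monoid.CoprodI.lift (fun i => (H i).subtype) w.prod =
      Monoid.CoprodI.lift (fun i => (H i).subtype) w'.prod) : w = w' := by
  classical
  exact Monoid.CoprodI.Word.equiv.symm.injective (hfp.1 h)

theorem NW.uniq (hfp : IsFreeProductOf H) {i j i' j' : ι} {n n' : ℕ} {g : G}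
    (hg : NW H i j n g) (hg' : NW H i' j' n' g) : i = i' ∧ j = j' ∧ n = n' := by
  have key : ∀ {i j i' j' : ι} {n n' : ℕ} {g : G}
    (hg : NW H i j n g) (hg' : NW H i' j' n' g), i = i' ∧ n = n' := by
    intro i j i' j' n n' g hg hg'
    obtain ⟨w, h1, h2, h3⟩ := hg.exists_word
    obtain ⟨w', h1', h2', h3'⟩ := hg'.exists_word
    obtain rfl := word_inj hfp (h3.trans h3'.symm)
    rw [h1] at h1'
    exact ⟨by simpa using h1', h2.symm.trans h2'⟩
  exact ⟨(key hg hg').1, (key hg.inv hg'.inv).1, (key hg hg').2⟩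

theorem NW.ne_one (hfp : IsFreeProductOf H) {i j : ι} {n : ℕ} {g : G}
    (hg : NW H i j n g) : g ≠ 1 := by
  rintro rfl
  obtain ⟨w, h1, h2, h3⟩ := hg.exists_word
  have : w = .empty := word_inj hfp (by simpa using h3)
  subst this
  simp [Monoid.CoprodI.Word.fstIdx] at h1

theorem eq_one_or_NW (hfp : IsFreeProductOf H) (g : G) : g = 1 ∨ ∃ i j n, NW H i j n g := by
  classical
  obtain ⟨c, rfl⟩ := hfp.2 g
  obtain ⟨w, rfl⟩ := Monoid.CoprodI.Word.equiv.symm.surjective c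
  change _ ∨ ∃ i j n, NW H i j n (Monoid.CoprodI.lift (fun i => (H i).subtype) w.prod)
  change Monoid.CoprodI.lift (fun i => (H i).subtype) w.prod = 1 ∨ _
  have : (w = .empty) ∨ ∃ i j n, w.fstIdx = some i ∧
      NW H i j n (Monoid.CoprodI.lift (fun i => (H i).subtype) w.prod) := by
    induction w using Monoid.CoprodI.Word.consRecOn with
    | empty => exact Or.inl rfl
    | cons i m w h1 h2 ih =>
      right
      have hm : (m : G) ≠ 1 := by simpa using h2
      rcases ih with rfl | ⟨k, j, n, hk, ih⟩
      · exact ⟨i, i, 1, by simp, by simpa using NW.single m.2 hm⟩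
      · refine ⟨i, j, n + 1, by simp, ?_⟩
        rw [Monoid.CoprodI.Word.prod_cons, map_mul, Monoid.CoprodI.lift_of]
        refine NW.cons m.2 hm ?_ ih
        rintro rfl
        exact h1 hk
  rcases this with rfl | ⟨i, j, n, -, h⟩
  · left; simp
  · exact Or.inr ⟨i, j, n, h⟩

/-- `g` does not start with a letter of `H i`. -/
def NS (H : ι → Subgroup G) (i : ι) (g : G) : Prop := ∀ l n, ¬ NW H i l n g

theorem NS.one (hfp : IsFreeProductOf H) (i : ι) : NS H i 1 := fun _ _ h => h.ne_one hfp rfl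

theorem NW.ns (hfp : IsFreeProductOf H) {i j k : ι} {n : ℕ} {g : G} (hg : NW H i j n g)
    (h : i ≠ k) : NS H k g := fun _ _ h' => h (hg.uniq hfp h').1

theorem mem_NW_eq (hfp : IsFreeProductOf H) {k i j : ι} {n : ℕ} {g : G} (hk : g ∈ H k)
    (hg : NW H i j n g) : i = k ∧ j = k ∧ n = 1 :=
  hg.uniq hfp (NW.single hk (hg.ne_one hfp))

theorem NS.mul_NW (hfp : IsFreeProductOf H) {i : ι} {x g : G} (hg : NS H i g) (hx : x ∈ H i)
    (h1 : x ≠ 1) : ∃ l n, NW H i l n (x * g) := by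
  rcases eq_one_or_NW hfp g with rfl | ⟨k, j, n, h⟩
  · exact ⟨i, 1, by simpa using NW.single hx h1⟩
  · refine ⟨j, n + 1, NW.cons hx h1 ?_ h⟩
    rintro rfl
    exact hg _ _ h

theorem NS.head_uniq (hfp : IsFreeProductOf H) {i : ι} {x x' g g' : G} (hg : NS H i g)
    (hg' : NS H i g') (hx : x ∈ H i) (hx' : x' ∈ H i) (h : x * g = x' * g') : x = x' := by
  by_contra hne
  obtain ⟨l, n, h2⟩ := hg.mul_NW hfp (mul_mem (inv_mem hx') hx)
    (by rw [Ne, inv_mul_eq_one]; exact fun h => hne h.symm)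
  rw [mul_assoc, h, inv_mul_cancel_left] at h2
  exact hg' _ _ h2

theorem exists_NS (hfp : IsFreeProductOf H) (i : ι) (g : G) :
    ∃ x g', x ∈ H i ∧ g = x * g' ∧ NS H i g' := by
  rcases eq_one_or_NW hfp g with rfl | ⟨k, j, n, h⟩
  · exact ⟨1, 1, one_mem _, by simp, NS.one hfp i⟩
  · by_cases hk : k = i
    · subst hk
      obtain ⟨x, g', hx, h1, he, h2⟩ := h.head
      refine ⟨x, g', hx, he, ?_⟩
      rcases h2 with ⟨rfl, -⟩ | ⟨k', m, hk', -, h2⟩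
      · exact NS.one hfp _
      · exact h2.ns hfp hk'
    · exact ⟨1, g, one_mem _, by simp, h.ns hfp hk⟩

open Classical in
/-- Length of the reduced word. -/
noncomputable def len (H : ι → Subgroup G) (g : G) : ℕ :=
  if h : ∃ n i j, NW H i j n g then h.choose else 0

theorem NW.len_eq (hfp : IsFreeProductOf H) {i j : ι} {n : ℕ} {g : G} (hg : NW H i j n g) :
    len H g = n := by
  have h : ∃ n i j, NW H i j n g := ⟨_, _, _, hg⟩
  rw [len, dif_pos h]
  obtain ⟨i', j', h'⟩ := h.choose_spec
  exact (h'.uniq hfp hg).2.2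

theorem len_one (hfp : IsFreeProductOf H) : len H (1 : G) = 0 := by
  rw [len, dif_neg]
  rintro ⟨n, i, j, h⟩
  exact h.ne_one hfp rfl

theorem len_mul_le (hfp : IsFreeProductOf H) {i : ι} {x : G} (hx : x ∈ H i) (g : G) :
    len H (x * g) ≤ len H g + 1 ∧ ((∃ l n, NW H i l n g) → len H (x * g) ≤ len H g) := by
  by_cases h1 : x = 1
  · subst h1; simp
  rcases eq_one_or_NW hfp g with rfl | ⟨k, j, n, h⟩
  · refine ⟨?_, fun ⟨l, n, h⟩ => absurd rfl (h.ne_one hfp)⟩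
    rw [mul_one, (NW.single hx h1).len_eq hfp]; omega
  · by_cases hk : k = i
    · subst hk
      have : len H (x * g) ≤ len H g := by
        rw [h.len_eq hfp]
        obtain ⟨y, g', hy, hy1, rfl, h2⟩ := h.head
        rw [← mul_assoc]
        have hxy := mul_mem hx hy
        by_cases h3 : x * y = 1
        · rw [h3, one_mul]
          rcases h2 with ⟨rfl, rfl, rfl⟩ | ⟨k', m, hk', rfl, h2⟩
          · rw [len_one hfp]; omega
          · rw [h2.len_eq hfp]; omega
        · rcases h2 with ⟨rfl, rfl, rfl⟩ | ⟨k', m, hk', rfl, h2⟩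
          · rw [mul_one, (NW.single hxy h3).len_eq hfp]
          · rw [(NW.cons hxy h3 hk'.symm h2).len_eq hfp]
      exact ⟨by omega, fun _ => this⟩
    · refine ⟨?_, fun ⟨l, m, h'⟩ => absurd (h.uniq hfp h').1 hk⟩
      rw [(NW.cons hx h1 (Ne.symm hk) h).len_eq hfp, h.len_eq hfp]

/-- each factor is self-normalizing -/
theorem mem_of_conj (hfp : IsFreeProductOf H) {i : ι} {x g : G} (hx : x ∈ H i)
    (h1 : x ≠ 1) (h : g * x * g⁻¹ ∈ H i) : g ∈ H i := by
  obtain ⟨t, g', ht, he, hn⟩ := exists_NS hfp i g⁻¹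
  have hg : g = g'⁻¹ * t⁻¹ := by rw [← mul_inv_rev, ← he, inv_inv]
  have hx' : t⁻¹ * x * t ∈ H i := mul_mem (mul_mem (inv_mem ht) hx) ht
  have hx1 : t⁻¹ * x * t ≠ 1 := by
    intro h2
    apply h1
    calc x = t * (t⁻¹ * x * t) * t⁻¹ := by group
      _ = 1 := by rw [h2]; group
  have heq : g * x * g⁻¹ = g'⁻¹ * (t⁻¹ * x * t) * g' := by rw [hg]; group
  rcases eq_one_or_NW hfp g' with rfl | ⟨k, j, n, h'⟩
  · rw [hg]; simpa using ht
  · exfalso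
    have hk : k ≠ i := by rintro rfl; exact hn _ _ h'
    have h3 := (h'.inv.append hk (NW.single hx' hx1)).append hk.symm h'
    rw [← heq] at h3
    have := (mem_NW_eq hfp h h3).2.2
    have := h'.pos
    omega

theorem hom_ext (hfp : IsFreeProductOf H) {K : Type*} [Monoid K] {f f' : G →* K}
    (h : ∀ i, ∀ x ∈ H i, f x = f' x) : f = f' := by
  have : f.comp (Monoid.CoprodI.lift fun i => (H i).subtype) =
      f'.comp (Monoid.CoprodI.lift fun i => (H i).subtype) := by
    apply Monoid.CoprodI.ext_hom
    intro i
    ext x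
    simpa using h i x x.2
  ext g
  obtain ⟨c, rfl⟩ := hfp.2 g
  exact DFunLike.congr_fun this c

theorem aut_ext (hfp : IsFreeProductOf H) {f f' : MulAut G}
    (h : ∀ i, ∀ x ∈ H i, f x = f' x) : f = f' := by
  have := hom_ext hfp (f := f.toMonoidHom) (f' := f'.toMonoidHom) h
  ext g
  exact DFunLike.congr_fun this g

theorem ind (hfp : IsFreeProductOf H) {K : Type*} [Group K] (f : G →* K) (S : Subgroup K)
    (h : ∀ i, ∀ x ∈ H i, f x ∈ S) (g : G) : f g ∈ S := by
  obtain ⟨c, rfl⟩ := hfp.2 g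
  induction c using Monoid.CoprodI.induction_on with
  | one => simp [one_mem]
  | of i m => simpa using h i m m.2
  | mul x y hx hy => rw [map_mul, map_mul]; exact mul_mem hx hy

/-- The universal property. -/
noncomputable def ext (hfp : IsFreeProductOf H) {K : Type*} [Group K] (f : ∀ i, H i →* K) :
    G →* K :=
  (Monoid.CoprodI.lift f).comp (MulEquiv.ofBijective _ hfp).symm.toMonoidHom

theorem ext_apply (hfp : IsFreeProductOf H) {K : Type*} [Group K] (f : ∀ i, H i →* K)
    {i : ι} {x : G} (hx : x ∈ H i) : ext hfp f x = f i ⟨x, hx⟩ := by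
  have : (MulEquiv.ofBijective _ hfp).symm x = Monoid.CoprodI.of (M := fun i => H i) (i := i) ⟨x, hx⟩ := by
    rw [MulEquiv.symm_apply_eq]
    exact (Monoid.CoprodI.lift_of (fun i => (H i).subtype) (⟨x, hx⟩ : H i)).symm
  change Monoid.CoprodI.lift f ((MulEquiv.ofBijective _ hfp).symm x) = _
  rw [this, Monoid.CoprodI.lift_of]

end Words

section Auts

variable {ι : Type*} {G : Type*} [Group G] {H : ι → Subgroup G}

open Classical in
/-- Partial conjugation endomorphism: conjugate `H k` by `x`, fix the other factors. -/
noncomputable def PC (hfp : IsFreeProductOf H) (k : ι) (x : G) : G →* G :=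
  ext hfp fun m => if m = k then (MulAut.conj x).toMonoidHom.comp (H m).subtype
    else (H m).subtype

theorem PC_same (hfp : IsFreeProductOf H) {k : ι} {x h : G} (hh : h ∈ H k) :
    PC hfp k x h = x * h * x⁻¹ := by
  simp [PC, ext_apply hfp _ hh]

theorem PC_ne (hfp : IsFreeProductOf H) {k m : ι} (hm : m ≠ k) {x h : G} (hh : h ∈ H m) :
    PC hfp k x h = h := by
  simp [PC, ext_apply hfp _ hh, hm]

theorem PC_mul (hfp : IsFreeProductOf H) {j k : ι} (hjk : j ≠ k) {x y : G} (_hx : x ∈ H j)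
    (hy : y ∈ H j) : (PC hfp k x).comp (PC hfp k y) = PC hfp k (y * x) := by
  apply hom_ext hfp
  intro m h hm
  by_cases hmk : m = k
  · subst hmk
    rw [MonoidHom.comp_apply, PC_same hfp hm, PC_same hfp hm, map_mul, map_mul, map_inv,
      PC_same hfp hm, PC_ne hfp hjk hy]
    group
  · rw [MonoidHom.comp_apply, PC_ne hfp hmk hm, PC_ne hfp hmk hm, PC_ne hfp hmk hm]

theorem PC_one (hfp : IsFreeProductOf H) (k : ι) : PC hfp k (1 : G) = MonoidHom.id G := by
  apply hom_ext hfp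
  intro m h hm
  by_cases hmk : m = k
  · subst hmk
    simp [PC_same hfp hm]
  · simp [PC_ne hfp hmk hm]

/-- Partial conjugation automorphisms; `A hfp hjk x` conjugates `H k` by `x⁻¹`. -/
noncomputable def A (hfp : IsFreeProductOf H) {j k : ι} (hjk : j ≠ k) : H j →* MulAut G where
  toFun x := MonoidHom.toMulEquiv (PC hfp k (x : G)⁻¹) (PC hfp k (x : G))
    (by rw [PC_mul hfp hjk x.2 (inv_mem x.2), inv_mul_cancel, PC_one])
    (by rw [PC_mul hfp hjk (inv_mem x.2) x.2, mul_inv_cancel, PC_one])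
  map_one' := by
    ext g
    simp [PC_one]
  map_mul' x y := by
    ext g
    have := PC_mul hfp hjk (inv_mem x.2) (inv_mem y.2)
    simp [← this]

theorem A_same (hfp : IsFreeProductOf H) {j k : ι} (hjk : j ≠ k) (x : H j) {h : G}
    (hh : h ∈ H k) : A hfp hjk x h = (x : G)⁻¹ * h * x := by
  change PC hfp k (x : G)⁻¹ h = _
  rw [PC_same hfp hh, inv_inv]

theorem A_ne (hfp : IsFreeProductOf H) {j k m : ι} (hjk : j ≠ k) (hm : m ≠ k) (x : H j) {h : G}
    (hh : h ∈ H m) : A hfp hjk x h = h := by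
  change PC hfp k (x : G)⁻¹ h = _
  rw [PC_ne hfp hm hh]

/-- `ψ` maps `H i` onto the conjugate by `g`. -/
def T (H : ι → Subgroup G) (ψ : MulAut G) (i : ι) (g : G) : Prop :=
  (H i).map (MulEquiv.toMonoidHom ψ) = (H i).map (MulEquiv.toMonoidHom (MulAut.conj g))

theorem T_iff {ψ : MulAut G} {i : ι} {g : G} :
    T H ψ i g ↔ ∀ x, x ∈ H i ↔ g⁻¹ * ψ x * g ∈ H i := by
  rw [T, SetLike.ext_iff, ψ.surjective.forall]
  refine forall_congr' fun x => ?_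
  have h1 : ψ x ∈ (H i).map (MulEquiv.toMonoidHom ψ) ↔ x ∈ H i := by
    rw [Subgroup.mem_map]
    constructor
    · rintro ⟨y, hy, h⟩
      rw [← ψ.injective h]; exact hy
    · exact fun h => ⟨x, h, rfl⟩
  have h2 : ψ x ∈ (H i).map (MulEquiv.toMonoidHom (MulAut.conj g)) ↔
      g⁻¹ * ψ x * g ∈ H i := by
    rw [Subgroup.mem_map]
    constructor
    · rintro ⟨y, hy, h⟩
      rw [← h]
      simpa [mul_assoc] using hy
    · intro h
      exact ⟨_, h, by simp [mul_assoc]⟩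
  rw [h1, h2]

theorem T.image {ψ : MulAut G} {i : ι} {g x : G} (h : T H ψ i g) (hx : x ∈ H i) :
    ∃ x' ∈ H i, ψ x = g * x' * g⁻¹ ∧ (x ≠ 1 → x' ≠ 1) := by
  refine ⟨_, (T_iff.1 h x).1 hx, by group, fun h1 h2 => h1 ?_⟩
  have : ψ x = 1 := by
    calc ψ x = g * (g⁻¹ * ψ x * g) * g⁻¹ := by group
      _ = 1 := by rw [h2]; group
  simpa using this

theorem T.conj {ψ : MulAut G} {i : ι} {g : G} (h : T H ψ i g) (a : G) :
    T H (MulAut.conj a * ψ) i (a * g) := by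
  rw [T_iff] at h ⊢
  intro x
  rw [h x, MulAut.mul_apply, MulAut.conj_apply]
  have : (a * g)⁻¹ * (a * ψ x * a⁻¹) * (a * g) = g⁻¹ * ψ x * g := by group
  rw [this]

theorem T.right {ψ : MulAut G} {i : ι} {g : G} (h : T H ψ i g) {t : G} (ht : t ∈ H i) :
    T H ψ i (g * t) := by
  rw [T_iff] at h ⊢
  intro x
  rw [h x]
  have : (g * t)⁻¹ * ψ x * (g * t) = t⁻¹ * (g⁻¹ * ψ x * g) * t := by group
  rw [this, (H i).mul_mem_cancel_right ht, (H i).mul_mem_cancel_left (inv_mem ht)]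

theorem T.uniq (hfp : IsFreeProductOf H) (hnt : ∀ i, H i ≠ ⊥) {ψ : MulAut G} {i : ι} {g g' : G}
    (h : T H ψ i g) (h' : T H ψ i g') : g⁻¹ * g' ∈ H i := by
  obtain ⟨x, hx, h1⟩ := ((H i).ne_bot_iff_exists_ne_one.1 (hnt i)) |>.elim
    fun a ha => (⟨a.1, a.2, fun h => ha (Subtype.ext h)⟩ : ∃ x, x ∈ H i ∧ x ≠ 1)
  refine mem_of_conj (x := g'⁻¹ * ψ x * g') hfp ((T_iff.1 h' x).1 hx) ?_ ?_
  · intro h2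
    apply h1
    have : ψ x = 1 := by
      calc ψ x = g' * (g'⁻¹ * ψ x * g') * g'⁻¹ := by group
        _ = 1 := by rw [h2]; group
    simpa using this
  · have : g⁻¹ * g' * (g'⁻¹ * ψ x * g') * (g⁻¹ * g')⁻¹ = g⁻¹ * ψ x * g := by group
    rw [this]
    exact (T_iff.1 h x).1 hx

theorem T.A_same (hfp : IsFreeProductOf H) {ψ : MulAut G} {j k : ι} (hjk : j ≠ k) {g : G}
    (h : T H ψ k g) (x : H j) : T H (ψ * A hfp hjk x) k ((ψ x)⁻¹ * g) := by
  rw [T_iff] at h ⊢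
  have key : ∀ y, y ∈ H k → ((ψ x)⁻¹ * g)⁻¹ * (ψ * A hfp hjk x) y * ((ψ x)⁻¹ * g) =
      g⁻¹ * ψ y * g := by
    intro y hy
    rw [MulAut.mul_apply, PureSym.A_same hfp hjk x hy, map_mul, map_mul, map_inv]
    group
  intro y
  constructor
  · intro hy
    rw [key y hy]
    exact (h y).1 hy
  · intro hy
    obtain ⟨z, hz⟩ := ψ.surjective (g * (((ψ x)⁻¹ * g)⁻¹ * (ψ * A hfp hjk x) y *
      ((ψ x)⁻¹ * g)) * g⁻¹)
    have hzk : z ∈ H k := by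
      rw [h z, hz]
      convert hy using 1
      group
    have h3 := key z hzk
    rw [hz] at h3
    have h4 : (ψ * A hfp hjk x) z = (ψ * A hfp hjk x) y := by
      have h5 : ((ψ x)⁻¹ * g)⁻¹ * (ψ * A hfp hjk x) z * ((ψ x)⁻¹ * g) =
        ((ψ x)⁻¹ * g)⁻¹ * (ψ * A hfp hjk x) y * ((ψ x)⁻¹ * g) := by
        rw [h3]; group
      exact mul_left_cancel (mul_right_cancel h5)
    rw [← (ψ * A hfp hjk x).injective h4]
    exact hzk

theorem T.A_ne (hfp : IsFreeProductOf H) {ψ : MulAut G} {j k m : ι} (hjk : j ≠ k) (hm : m ≠ k)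
    {g : G} (h : T H ψ m g) (x : H j) : T H (ψ * A hfp hjk x) m g := by
  rw [T_iff] at h ⊢
  intro y
  by_cases hy : y ∈ H m
  · rw [h y, MulAut.mul_apply, PureSym.A_ne hfp hjk hm x hy]
  · refine ⟨fun h' => absurd h' hy, fun h' => absurd ?_ hy⟩
    rw [MulAut.mul_apply, ← h] at h'
    have h6 := PureSym.A_ne hfp hjk hm x h'
    rw [← (A hfp hjk x).injective h6]
    exact h'

end Auts

section Inj

variable {G : Type*} [Group G] {H : Fin 3 → Subgroup G}

theorem ne_succ (j : Fin 3) : j ≠ j + 1 := by revert j; decide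

/-- Ping-pong domains. -/
def X (H : Fin 3 → Subgroup G) (j : Fin 3) (ψ : MulAut G) : Prop :=
  ∃ (k l : Fin 3) (a y p q : G), j ≠ k ∧ j ≠ l ∧ k ≠ l ∧ y ∈ H j ∧ y ≠ 1 ∧ NS H j p ∧ NS H j q ∧
    T H ψ j a ∧ T H ψ k (a * p) ∧ T H ψ l (a * y * q)

theorem X.choose {i k l : Fin 3} {ψ : MulAut G} (h : X H i ψ) (hik : i ≠ k) (hil : i ≠ l)
    (hkl : k ≠ l) : ∃ a y p q : G, y ∈ H i ∧ y ≠ 1 ∧ NS H i p ∧ NS H i q ∧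
    T H ψ i a ∧ T H ψ k (a * p) ∧ T H ψ l (a * y * q) := by
  obtain ⟨k', l', a, y, p, q, h1, h2, h3, hy, hy1, hp, hq, ha, hk, hl⟩ := h
  have : (k' = k ∧ l' = l) ∨ (k' = l ∧ l' = k) := by
    revert i k l k' l'; intros; omega
  rcases this with ⟨rfl, rfl⟩ | ⟨rfl, rfl⟩
  · exact ⟨a, y, p, q, hy, hy1, hp, hq, ha, hk, hl⟩
  · refine ⟨a * y, y⁻¹, q, p, inv_mem hy, by simpa using hy1, hq, hp, ha.right hy, hl, ?_⟩
    simpa using hk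

theorem X_step_aux (hfp : IsFreeProductOf H) {ψ : MulAut G} {i j l : Fin 3} (hij : j ≠ i)
    (hjl : j ≠ l) (hil : i ≠ l) {b r s : G} (hr : NS H j r) (hs : NS H j s)
    (hb : T H ψ j b) (hi : T H ψ i (b * r)) (hl : T H ψ l (b * s)) {x : H j} (hx : x ≠ 1) :
    X H j (ψ * A hfp (ne_succ j) x) := by
  wlog hji : i = j + 1 generalizing i l r s
  · refine this hjl hij hil.symm hs hr hl hi ?_
    omega
  subst hji
  obtain ⟨x', hx', he, hne⟩ := hb.image x.2
  refine ⟨l, j + 1, b, x'⁻¹, s, r, hjl, hij, hil.symm, inv_mem hx', ?_, hs, hr,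
    hb.A_ne hfp _ hij x, hl.A_ne hfp _ hil.symm x, ?_⟩
  · simpa using hne (by simpa using hx)
  · have := hi.A_same hfp (ne_succ j) x
    rw [he] at this
    convert this using 1
    group

theorem X_base (hfp : IsFreeProductOf H) {ψ : MulAut G} {g : G} (h : ∀ i, T H ψ i g) (j : Fin 3)
    {x : H j} (hx : x ≠ 1) : X H j (ψ * A hfp (ne_succ j) x) :=
  X_step_aux hfp (i := j + 1) (l := j + 2) (b := g) (r := 1) (s := 1)
    (by omega) (by omega) (by omega) (NS.one hfp j) (NS.one hfp j) (h j) (by simpa using h _)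
    (by simpa using h _) hx

theorem X_step (hfp : IsFreeProductOf H) {ψ : MulAut G} {i j : Fin 3} (h : X H i ψ) (hij : i ≠ j)
    {x : H j} (hx : x ≠ 1) : X H j (ψ * A hfp (ne_succ j) x) := by
  obtain ⟨l, hil, hjl⟩ : ∃ l, i ≠ l ∧ j ≠ l :=
    (by decide : ∀ i j : Fin 3, ∃ l, i ≠ l ∧ j ≠ l) i j
  obtain ⟨a, y, p, q, hy, hy1, hp, hq, ha, hj, hl⟩ := h.choose hij hil hjl
  obtain ⟨t, p', ht, he, hn⟩ := exists_NS hfp j p⁻¹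
  have hpe : p = p'⁻¹ * t⁻¹ := by rw [← mul_inv_rev, ← he, inv_inv]
  have hb : T H ψ j (a * p'⁻¹) := by
    have := hj.right ht
    rw [hpe] at this
    convert this using 1
    group
  refine X_step_aux hfp (i := i) (l := l) (b := a * p'⁻¹) (r := p') (s := p' * (y * q)) hij.symm
    hjl hil hn ?_ hb (by simpa using ha) (by simpa [mul_assoc] using hl) hx
  obtain ⟨l', n', hyq⟩ := hq.mul_NW hfp hy hy1
  rcases eq_one_or_NW hfp p' with rfl | ⟨u, v, n, hp'⟩
  · rw [one_mul]; exact hyq.ns hfp hij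
  · have hu : u ≠ j := by rintro rfl; exact hn _ _ hp'
    have hv : v ≠ i := by
      rintro rfl
      by_cases ht1 : t = 1
      · rw [ht1, inv_one, mul_one] at hpe
        rw [hpe] at hp
        exact hp _ _ hp'.inv
      · have := hp'.inv.append hu (NW.single (inv_mem ht) (by simpa using ht1))
        rw [← hpe] at this
        exact hp _ _ this
    exact (hp'.append hv hyq).ns hfp hu

theorem X_not_base (hfp : IsFreeProductOf H) (hnt : ∀ i, H i ≠ ⊥) {ψ : MulAut G} {g : G}
    (h : ∀ i, T H ψ i g) {j : Fin 3} (hX : X H j ψ) : False := by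
  obtain ⟨k, l, a, y, p, q, h1, h2, h3, hy, hy1, hp, hq, ha, hk, hl⟩ := hX
  have e1 := ha.uniq hfp hnt (h j)
  have e2 := hk.uniq hfp hnt (h k)
  have e3 := hl.uniq hfp hnt (h l)
  have key : ∀ {m : Fin 3} {t : G}, j ≠ m → t ∈ H m → NS H j t := by
    intro m t hm ht l n h'
    exact hm (mem_NW_eq hfp ht h').1
  have f1 : a⁻¹ * g = 1 := by
    refine NS.head_uniq (i := j) (g := ((a * p)⁻¹ * g)⁻¹) (g' := p) hfp
      (key h1 (inv_mem e2)) hp e1 (one_mem _) ?_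
    group
  have f2 : a⁻¹ * g = y := by
    refine NS.head_uniq (i := j) (g := ((a * y * q)⁻¹ * g)⁻¹) (g' := q) hfp
      (key h2 (inv_mem e3)) hq e1 hy ?_
    group
  exact hy1 (f2.symm.trans f1)

/-- The lift of `G → Out`. -/
noncomputable def W (hfp : IsFreeProductOf H) : G →* MulAut G :=
  ext hfp fun j => A hfp (ne_succ j)

theorem W_apply (hfp : IsFreeProductOf H) {j : Fin 3} {x : G} (hx : x ∈ H j) :
    W hfp x = A hfp (ne_succ j) ⟨x, hx⟩ := ext_apply hfp _ hx

theorem W_X (hfp : IsFreeProductOf H) {i j : Fin 3} {n : ℕ} {w : G} (hw : NW H i j n w)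
    (ψ : MulAut G) (h : (∃ g, ∀ i, T H ψ i g) ∨ ∃ k, k ≠ i ∧ X H k ψ) : X H j (ψ * W hfp w) := by
  have one : ∀ {i : Fin 3} {x : G} (hx : x ∈ H i) (h1 : x ≠ 1) (ψ : MulAut G)
      (h : (∃ g, ∀ i, T H ψ i g) ∨ ∃ k, k ≠ i ∧ X H k ψ), X H i (ψ * W hfp x) := by
    intro i x hx h1 ψ h
    rw [W_apply hfp hx]
    have h1' : (⟨x, hx⟩ : H i) ≠ 1 := fun h => h1 (congrArg Subtype.val h)
    rcases h with ⟨g, h⟩ | ⟨k, hk, h⟩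
    · exact X_base hfp h i h1'
    · exact X_step hfp h hk h1'
  induction hw generalizing ψ with
  | single hx h1 => exact one hx h1 ψ h
  | cons hx h1 hik hg ih =>
    rw [map_mul, ← mul_assoc]
    exact ih _ (Or.inr ⟨_, hik, one hx h1 ψ h⟩)

theorem T_one_one (i : Fin 3) : T H 1 i (1 : G) := by
  rw [T_iff]; simp

theorem W_inj (hfp : IsFreeProductOf H) (hnt : ∀ i, H i ≠ ⊥) {w g : G}
    (h : ∀ i, T H (W hfp w) i g) : w = 1 := by
  rcases eq_one_or_NW hfp w with h1 | ⟨i, j, n, hw⟩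
  · exact h1
  · have := W_X hfp hw 1 (Or.inl ⟨1, T_one_one⟩)
    rw [one_mul] at this
    exact (X_not_base hfp hnt h this).elim

end Inj

section Surj

variable {G : Type*} [Group G] {H : Fin 3 → Subgroup G}

/-- The case where the centre of the tripod has trivial stabilizer. -/
theorem trivial_of_inj (hfp : IsFreeProductOf H) (hnt : ∀ i, H i ≠ ⊥) {ψ : MulAut G}
    {g : Fin 3 → G} (hg : ∀ i, T H ψ i (g i)) (τ : Fin 3 → Fin 3) (hτ : Function.Injective τ)
    (h1 : ∀ i, (g i = 1 ∧ τ i = i) ∨ ∃ l n, l ≠ i ∧ NW H (τ i) l n (g i)) (k : Fin 3) :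
    g k = 1 := by
  have one : ∀ {i : Fin 3} {x : G} (hx : x ∈ H i) (hx1 : x ≠ 1),
      NW H (τ i) (τ i) (2 * len H (g i) + 1) (ψ x) := by
    intro i x hx hx1
    obtain ⟨x', hx', he, hne⟩ := (hg i).image hx
    rw [he]
    rcases h1 i with ⟨hi, hi'⟩ | ⟨l, n, hl, hi⟩
    · rw [hi, hi', len_one hfp]
      simpa using NW.single hx' (hne hx1)
    · have := (hi.append hl (NW.single hx' (hne hx1))).append hl.symm hi.inv
      rw [hi.len_eq hfp]
      convert this using 1
      omega
  have key : ∀ {i j : Fin 3} {n : ℕ} {w : G}, NW H i j n w → ∃ n', n ≤ n' ∧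
      2 * len H (g i) + 1 ≤ n' ∧ NW H (τ i) (τ j) n' (ψ w) := by
    intro i j n w hw
    induction hw with
    | single hx hx1 => exact ⟨_, by omega, le_rfl, one hx hx1⟩
    | cons hx hx1 hik hw ih =>
      obtain ⟨n', h2, h3, h4⟩ := ih
      rw [map_mul]
      exact ⟨_, by omega, by omega, (one hx hx1).append (fun h => hik (hτ h)) h4⟩
  obtain ⟨x, hx1⟩ := (H k).ne_bot_iff_exists_ne_one.1 (hnt k)
  have hx1' : (x : G) ≠ 1 := by simpa using hx1
  obtain ⟨w, hw⟩ := ψ.surjective (x : G)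
  rcases eq_one_or_NW hfp w with rfl | ⟨i, j, n, h⟩
  · rw [map_one] at hw
    exact absurd hw.symm hx1'
  · obtain ⟨n', h2, h3, h4⟩ := key h
    rw [hw] at h4
    obtain ⟨h5, h6, h7⟩ := mem_NW_eq hfp x.2 h4
    have hlen : len H (g i) = 0 := by omega
    rcases h1 i with ⟨hi, hi'⟩ | ⟨l, m, hl, hi⟩
    · rw [hi'] at h5
      rw [← h5]; exact hi
    · rw [hi.len_eq hfp] at hlen
      have := hi.pos
      omega

/-- The case where the centre of the tripod has nontrivial stabilizer. -/
theorem false_of_center (hfp : IsFreeProductOf H) (hnt : ∀ i, H i ≠ ⊥) {ψ : MulAut G}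
    {g : Fin 3 → G} (hg : ∀ i, T H ψ i (g i)) (k : Fin 3) (y g' : Fin 3 → G)
    (hy : Function.Injective y) (hyk : ∀ i, y i ∈ H k) (he : ∀ i, g i = y i * g' i)
    (h1 : ∀ i, (g' i = 1 ∧ k ≠ i) ∨ ∃ u l n, u ≠ k ∧ l ≠ i ∧ NW H u l n (g' i)) : False := by
  have one : ∀ {i : Fin 3} {x : G} (hx : x ∈ H i) (hx1 : x ≠ 1),
      ∃ u v n z, u ≠ k ∧ v ≠ k ∧ NW H u v n z ∧ ψ x = y i * z * (y i)⁻¹ := by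
    intro i x hx hx1
    obtain ⟨x', hx', hex, hne⟩ := (hg i).image hx
    rw [hex, he i]
    rcases h1 i with ⟨hi, hi'⟩ | ⟨u, l, n, hu, hl, hi⟩
    · exact ⟨i, i, 1, x', hi'.symm, hi'.symm, NW.single hx' (hne hx1), by rw [hi]; group⟩
    · refine ⟨u, u, _, _, hu, hu,
        (hi.append hl (NW.single hx' (hne hx1))).append hl.symm hi.inv, by group⟩
  have key : ∀ {i j : Fin 3} {n : ℕ} {w : G}, NW H i j n w →
      ∃ u v n z, u ≠ k ∧ v ≠ k ∧ NW H u v n z ∧ ψ w = y i * z * (y j)⁻¹ := by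
    intro i j n w hw
    induction hw with
    | single hx hx1 => exact one hx hx1
    | @cons i m j n x w hx hx1 hik hw ih =>
      obtain ⟨u, v, n, z, hu, hv, hz, hez⟩ := ih
      obtain ⟨u', v', n', z', hu', hv', hz', hez'⟩ := one hx hx1
      have hyy : (y i)⁻¹ * y m ≠ 1 := by
        rw [Ne, inv_mul_eq_one]
        exact fun h => hik (hy h)
      refine ⟨u', v, _, _, hu', hv, (hz'.append hv' (NW.single
        (mul_mem (inv_mem (hyk i)) (hyk m)) hyy)).append hu.symm hz, ?_⟩
      rw [map_mul, hez, hez']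
      group
  obtain ⟨x, hx1⟩ := (H k).ne_bot_iff_exists_ne_one.1 (hnt k)
  have hx1' : (x : G) ≠ 1 := by simpa using hx1
  obtain ⟨w, hw⟩ := ψ.surjective (x : G)
  rcases eq_one_or_NW hfp w with rfl | ⟨i, j, n, h⟩
  · rw [map_one] at hw
    exact absurd hw.symm hx1'
  · obtain ⟨u, v, n, z, hu, hv, hz, hez⟩ := key h
    have : z ∈ H k := by
      have : z = (y i)⁻¹ * x * y j := by rw [← hw, hez]; group
      rw [this]
      exact mul_mem (mul_mem (inv_mem (hyk i)) x.2) (hyk j)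
    exact hu (mem_NW_eq hfp this hz).1

theorem mem_of_T (hfp : IsFreeProductOf H) (hnt : ∀ i, H i ≠ ⊥) (M : Subgroup (MulAut G))
    (hconj : ∀ a, MulAut.conj a ∈ M) (hA : ∀ {j k : Fin 3} (h : j ≠ k) (x : H j), A hfp h x ∈ M)
    (hΦ : ∀ ψ : MulAut G, (∀ i, T H ψ i 1) → ψ ∈ M) (N : ℕ) :
    ∀ (ψ : MulAut G) (g : Fin 3 → G), (∀ i, T H ψ i (g i)) → ∑ i, len H (g i) = N → ψ ∈ M := by
  induction N using Nat.strong_induction_on with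
  | _ N IH =>
  intro ψ g hg hN
  by_contra hψ
  -- no `g i` ends in `H i`
  have ha : ∀ i k n, ¬ NW H k i n (g i) := by
    intro i k n h
    obtain ⟨x, g', hx, hx1, he, h2⟩ := h.last
    have hl : len H g' < len H (g i) := by
      rw [h.len_eq hfp]
      rcases h2 with ⟨rfl, rfl, rfl⟩ | ⟨k', m, hk', rfl, h2⟩
      · rw [len_one hfp]; omega
      · rw [h2.len_eq hfp]; omega
    refine hψ (IH (∑ m, len H (Function.update g i g' m)) ?_ ψ (Function.update g i g') ?_ rfl)
    · rw [← hN]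
      refine Finset.sum_lt_sum (fun m _ => ?_) ⟨i, Finset.mem_univ _, by simpa using hl⟩
      by_cases hm : m = i
      · subst hm; simpa using hl.le
      · simp [hm]
    · intro m
      by_cases hm : m = i
      · subst hm
        have := (hg m).right (inv_mem hx)
        rw [he, mul_inv_cancel_right] at this
        simpa using this
      · simpa [hm] using hg m
  -- heads
  have hhead : ∀ {k l n} {a : G}, NW H k l n a → ∃ y a', y ∈ H k ∧ y ≠ 1 ∧ a = y * a' ∧
      NS H k a' ∧ len H a' < len H a := by
    intro k l n a h
    obtain ⟨x, g', hx, hx1, he, h2⟩ := h.head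
    refine ⟨x, g', hx, hx1, he, ?_⟩
    rw [h.len_eq hfp]
    rcases h2 with ⟨rfl, rfl, rfl⟩ | ⟨k', m, hk', rfl, h2⟩
    · rw [len_one hfp]; exact ⟨NS.one hfp _, by omega⟩
    · rw [h2.len_eq hfp]; exact ⟨h2.ns hfp hk', by omega⟩
  have hb : ∀ k j l n, g k = 1 → ¬ NW H k l n (g j) := by
    intro k j l n hk h
    have hjk : k ≠ j := by
      rintro rfl
      exact h.ne_one hfp hk
    obtain ⟨y, g', hy, hy1, he, -, hl⟩ := hhead h
    obtain ⟨x, hx⟩ := ψ.surjective y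
    have hxk : x ∈ H k := by
      rw [T_iff.1 (hg k) x, hk, hx]
      simpa using hy
    have hmem : ψ * A hfp hjk ⟨x, hxk⟩ ∈ M := by
      refine IH (∑ m, len H (Function.update g j g' m)) ?_ _ (Function.update g j g') ?_ rfl
      · rw [← hN]
        refine Finset.sum_lt_sum (fun m _ => ?_) ⟨j, Finset.mem_univ _, by simpa using hl⟩
        by_cases hm : m = j
        · subst hm; simpa using hl.le
        · simp [hm]
      · intro m
        by_cases hm : m = j
        · subst hm
          have := (hg m).A_same hfp hjk ⟨x, hxk⟩
          simpa [hx, he] using this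
        · simpa [hm] using (hg m).A_ne hfp hjk hm ⟨x, hxk⟩
    exact hψ ((M.mul_mem_cancel_right (hA hjk _)).1 hmem)
  have hleft : ∀ a : G, N ≤ ∑ m, len H (a * g m) := by
    intro a
    by_contra hlt
    push Not at hlt
    exact hψ ((M.mul_mem_cancel_left (hconj a)).1
      (IH _ hlt (MulAut.conj a * ψ) (fun m => a * g m) (fun m => (hg m).conj a) rfl))
  by_cases hcase : ∃ k i j, i ≠ j ∧ (∃ l n, NW H k l n (g i)) ∧ ∃ l n, NW H k l n (g j)
  · obtain ⟨k, i, j, hij, ⟨li, ni, hi⟩, ⟨lj, nj, hj⟩⟩ := hcase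
    obtain ⟨l, hil, hjl⟩ : ∃ l, i ≠ l ∧ j ≠ l :=
      (by decide : ∀ i j : Fin 3, ∃ l, i ≠ l ∧ j ≠ l) i j
    have hsum : ∀ f : Fin 3 → ℕ, ∑ m, f m = f i + f j + f l := by
      intro f
      have : (Finset.univ : Finset (Fin 3)) = {i, j, l} := by
        ext m
        simp only [Finset.mem_univ, Finset.mem_insert, Finset.mem_singleton, true_iff]
        omega
      rw [this, Finset.sum_insert (by simp [hij, hil]), Finset.sum_insert (by simp [hjl]),
        Finset.sum_singleton, add_assoc]
    simp only [hsum] at hN hleft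
    obtain ⟨yi, gi, hyi, hyi1, hei, hnsi, hleni⟩ := hhead hi
    obtain ⟨yj, gj, hyj, hyj1, hej, hnsj, hlenj⟩ := hhead hj
    have hL := hleft yi⁻¹
    have hgi : yi⁻¹ * g i = gi := by rw [hei]; group
    rw [hgi] at hL
    have hbj := (len_mul_le hfp (inv_mem hyi) (g j)).2 ⟨_, _, hj⟩
    have hbl := len_mul_le hfp (inv_mem hyi) (g l)
    have hij' : yi ≠ yj := by
      rintro rfl
      have hgj : yi⁻¹ * g j = gj := by rw [hej]; group
      rw [hgj] at hL
      omega
    have hnl : NS H k (g l) := by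
      intro l' n' hl
      have := hbl.2 ⟨_, _, hl⟩
      omega
    have hall : ∀ m, m = i ∨ m = j ∨ m = l := by
      intro m; omega
    -- decomposition
    have hdec : ∀ m (y a : G), y ∈ H k → g m = y * a → NS H k a →
        (a = 1 ∧ k ≠ m) ∨ ∃ u l n, u ≠ k ∧ l ≠ m ∧ NW H u l n a := by
      intro m y a hy he hns
      rcases eq_one_or_NW hfp a with rfl | ⟨u, v, n, h⟩
      · left
        refine ⟨rfl, ?_⟩
        rintro rfl
        rw [mul_one] at he
        by_cases hy1 : y = 1
        · rw [hy1] at he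
          exact hb k i _ _ he hi
        · apply ha k k 1
          rw [he]
          exact NW.single hy hy1
      · right
        have hu : u ≠ k := by rintro rfl; exact hns _ _ h
        refine ⟨u, v, n, hu, ?_, h⟩
        rintro rfl
        by_cases hy1 : y = 1
        · rw [hy1, one_mul] at he
          apply ha v u n
          rw [he]; exact h
        · apply ha v k (n + 1)
          rw [he]; exact NW.cons hy hy1 hu.symm h
    have hD : ∀ m, ∃ y a, y ∈ H k ∧ g m = y * a ∧ NS H k a ∧
        ((m = i ∧ y = yi) ∨ (m = j ∧ y = yj) ∨ (m = l ∧ y = 1)) := by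
      intro m
      rcases hall m with rfl | rfl | rfl
      · exact ⟨yi, gi, hyi, hei, hnsi, Or.inl ⟨rfl, rfl⟩⟩
      · exact ⟨yj, gj, hyj, hej, hnsj, Or.inr (Or.inl ⟨rfl, rfl⟩)⟩
      · exact ⟨1, g m, one_mem _, by simp, hnl, Or.inr (Or.inr ⟨rfl, rfl⟩)⟩
    choose y a hyk he hns hy using hD
    refine false_of_center hfp hnt hg k y a ?_ hyk he (fun m => hdec m _ _ (hyk m) (he m) (hns m))
    intro m m' hmm
    rcases hy m with ⟨h, h'⟩ | ⟨h, h'⟩ | ⟨h, h'⟩ <;>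
    rcases hy m' with ⟨h2, h2'⟩ | ⟨h2, h2'⟩ | ⟨h2, h2'⟩ <;>
    rw [h', h2'] at hmm <;> first | exact h.trans h2.symm | exact absurd hmm ‹_› |
      exact absurd hmm.symm ‹_›
  · have hD : ∀ i, ∃ t, (g i = 1 ∧ t = i) ∨ ∃ l n, l ≠ i ∧ NW H t l n (g i) := by
      intro i
      rcases eq_one_or_NW hfp (g i) with h | ⟨u, v, n, h⟩
      · exact ⟨i, Or.inl ⟨h, rfl⟩⟩
      · refine ⟨u, Or.inr ⟨v, n, ?_, h⟩⟩
        rintro rfl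
        exact ha _ _ _ h
    choose τ hτ using hD
    have hinj : Function.Injective τ := by
      intro i j hij
      by_contra hne
      rcases hτ i with ⟨h1, h2⟩ | ⟨l, n, -, h⟩ <;> rcases hτ j with ⟨h1', h2'⟩ | ⟨l', n', -, h'⟩
      · exact hne (by rw [← h2, ← h2', hij])
      · rw [← hij, h2] at h'
        exact hb _ _ _ _ h1 h'
      · rw [hij, h2'] at h
        exact hb _ _ _ _ h1' h
      · rw [← hij] at h'
        exact hcase ⟨τ i, i, j, hne, ⟨_, _, h⟩, ⟨_, _, h'⟩⟩
    refine hψ (hΦ ψ fun i => ?_)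
    rw [← trivial_of_inj hfp hnt hg τ hinj hτ i]
    exact hg i

end Surj

section Final

variable {G : Type*} [Group G] {H : Fin 3 → Subgroup G}

theorem T_conj (a : G) (i : Fin 3) : T H (MulAut.conj a) i a := rfl

theorem T_A (hfp : IsFreeProductOf H) {j k : Fin 3} (hjk : j ≠ k) (x : H j) (i : Fin 3) :
    ∃ g, T H (A hfp hjk x) i g := by
  by_cases hi : i = k
  · subst hi
    have := (T_one_one (H := H) i).A_same hfp hjk x
    rw [one_mul] at this
    exact ⟨_, this⟩
  · have := (T_one_one (H := H) i).A_ne hfp hjk hi x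
    rw [one_mul] at this
    exact ⟨_, this⟩

theorem T_θ (θ : (∀ i, MulAut ↥(H i)) →* MulAut G)
    (hθ : ∀ (φ : ∀ i, MulAut ↥(H i)) (i : Fin 3) (x : ↥(H i)),
      θ φ (x : G) = ((φ i x : ↥(H i)) : G)) (φ : ∀ i, MulAut ↥(H i)) (i : Fin 3) :
    T H (θ φ) i 1 := by
  rw [T_iff]
  intro x
  simp only [inv_one, one_mul, mul_one]
  constructor
  · intro hx
    have := hθ φ i ⟨x, hx⟩
    simp only at this
    rw [this]
    exact SetLike.coe_mem _
  · intro hx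
    have := hθ φ⁻¹ i ⟨_, hx⟩
    simp only [map_inv, MulAut.inv_apply_self] at this
    rw [this]
    exact SetLike.coe_mem _

/-- restriction of an automorphism preserving all factors -/
theorem exists_θ (hfp : IsFreeProductOf H) (θ : (∀ i, MulAut ↥(H i)) →* MulAut G)
    (hθ : ∀ (φ : ∀ i, MulAut ↥(H i)) (i : Fin 3) (x : ↥(H i)),
      θ φ (x : G) = ((φ i x : ↥(H i)) : G)) (ψ : MulAut G) (h : ∀ i, T H ψ i 1) :
    ∃ φ, θ φ = ψ := by
  have hmem : ∀ i x, x ∈ H i ↔ ψ x ∈ H i := by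
    intro i x
    simpa using T_iff.1 (h i) x
  let φ : ∀ i, MulAut ↥(H i) := fun i =>
    { toFun := fun x => ⟨ψ x, (hmem i x).1 x.2⟩
      invFun := fun x => ⟨ψ.symm x, by rw [hmem]; simp⟩
      left_inv := fun x => by ext; simp
      right_inv := fun x => by ext; simp
      map_mul' := fun x y => by ext; simp }
  refine ⟨φ, aut_ext hfp fun i x hx => ?_⟩
  exact hθ φ i ⟨x, hx⟩

theorem θ_inj (hfp : IsFreeProductOf H) (hnt : ∀ i, H i ≠ ⊥)
    (θ : (∀ i, MulAut ↥(H i)) →* MulAut G)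
    (hθ : ∀ (φ : ∀ i, MulAut ↥(H i)) (i : Fin 3) (x : ↥(H i)),
      θ φ (x : G) = ((φ i x : ↥(H i)) : G)) (φ : ∀ i, MulAut ↥(H i)) (a : G)
    (h : θ φ = MulAut.conj a) : φ = 1 := by
  have hmem : ∀ i, a ∈ H i := by
    intro i
    have h1 := T_θ θ hθ φ i
    rw [h] at h1
    simpa using h1.uniq hfp hnt (T_conj a i)
  have ha : a = 1 := by
    by_contra ha
    exact absurd (mem_NW_eq hfp (hmem 1) (NW.single (hmem 0) ha)).1 (by decide)
  rw [ha, map_one] at h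
  funext i
  ext x
  rw [← hθ, h]
  rfl

theorem W_compat (hfp : IsFreeProductOf H) (θ : (∀ i, MulAut ↥(H i)) →* MulAut G)
    (hθ : ∀ (φ : ∀ i, MulAut ↥(H i)) (i : Fin 3) (x : ↥(H i)),
      θ φ (x : G) = ((φ i x : ↥(H i)) : G)) (φ : ∀ i, MulAut ↥(H i)) :
    (W hfp).comp (MulEquiv.toMonoidHom (θ φ)) =
      (MulEquiv.toMonoidHom (MulAut.conj (θ φ))).comp (W hfp) := by
  apply hom_ext hfp
  intro j x hx
  have hx' := hθ φ j ⟨x, hx⟩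
  simp only at hx'
  simp only [MonoidHom.comp_apply, MulEquiv.coe_toMonoidHom, MulAut.conj_apply]
  rw [hx', W_apply hfp (SetLike.coe_mem _), W_apply hfp hx, eq_mul_inv_iff_mul_eq]
  apply aut_ext hfp
  intro m h hm
  have hm' := hθ φ m ⟨h, hm⟩
  simp only at hm'
  rw [MulAut.mul_apply, MulAut.mul_apply]
  by_cases hmj : m = j + 1
  · subst hmj
    rw [hm', A_same hfp _ _ (SetLike.coe_mem _), A_same hfp _ _ hm, map_mul, map_mul, map_inv,
      hm']
    simp only [hx']
  · rw [hm', A_ne hfp _ hmj _ (SetLike.coe_mem _), A_ne hfp _ hmj _ hm, hm']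

end Final

end PureSym

open PureSym in
/-- for a free product `G = G₁ * G₂ * G₃` of three nontrivial groups, the
group of pure symmetric outer automorphisms (`S` = pure symmetric automorphisms, `N` = the
inner automorphisms inside `S`) is isomorphic to the semidirect product `G ⋊ Φ` where
`Φ ≅ Aut(G₁) × Aut(G₂) × Aut(G₃)` acts on `G` through factor automorphisms (the
homomorphism `θ`, acting on each factor `H i` through its `Aut(H i)`-component). -/
theorem stmt_13 {G : Type*} [Group G] (H : Fin 3 → Subgroup G)
    (hfp : IsFreeProductOf H) (hnt : ∀ i, H i ≠ ⊥)
    (S : Subgroup (MulAut G)) (hS : ∀ ψ : MulAut G, ψ ∈ S ↔ IsPureSymmetric H ψ)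
    (N : Subgroup S) (hN : ∀ ψ : S, ψ ∈ N ↔ ∃ g : G, (ψ : MulAut G) = MulAut.conj g)
    [hNn : N.Normal]
    (θ : (∀ i, MulAut ↥(H i)) →* MulAut G)
    (hθ : ∀ (φ : ∀ i, MulAut ↥(H i)) (i : Fin 3) (x : ↥(H i)),
      θ φ (x : G) = ((φ i x : ↥(H i)) : G)) :
    Nonempty ((S ⧸ N) ≃* SemidirectProduct G (∀ i, MulAut ↥(H i)) θ) := by
  have memS : ∀ {ψ : MulAut G}, (∀ i, ∃ g, T H ψ i g) → ψ ∈ S := fun h => (hS _).2 h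
  have hθS : ∀ φ, θ φ ∈ S := fun φ => memS fun i => ⟨1, T_θ θ hθ φ i⟩
  have hAS : ∀ {j k : Fin 3} (h : j ≠ k) (x : H j), A hfp h x ∈ S :=
    fun h x => memS fun i => T_A hfp h x i
  have hcS : ∀ a : G, MulAut.conj a ∈ S := fun a => memS fun i => ⟨a, T_conj a i⟩
  have hWS : ∀ g, W hfp g ∈ S := ind hfp _ _ fun i x hx => by
    rw [W_apply hfp hx]; exact hAS _ _
  let F : SemidirectProduct G (∀ i, MulAut ↥(H i)) θ →* MulAut G :=
    SemidirectProduct.lift (W hfp) θ (W_compat hfp θ hθ)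
  have hF : ∀ p, F p = W hfp p.1 * θ p.2 := fun p => rfl
  have hFS : ∀ p, F p ∈ S := fun p => by
    rw [hF]; exact mul_mem (hWS _) (hθS _)
  let f : SemidirectProduct G (∀ i, MulAut ↥(H i)) θ →* S ⧸ N :=
    (QuotientGroup.mk' N).comp (F.codRestrict S hFS)
  have hf : ∀ p, f p = QuotientGroup.mk' N ⟨F p, hFS p⟩ := fun p => rfl
  have hinj : Function.Injective f := by
    rw [injective_iff_map_eq_one]
    intro p hp
    rw [hf, QuotientGroup.mk'_apply, QuotientGroup.eq_one_iff, hN] at hp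
    obtain ⟨a, ha⟩ := hp
    simp only [hF] at ha
    have hW : W hfp p.1 = MulAut.conj a * θ p.2⁻¹ := by
      rw [← ha, map_inv, mul_inv_cancel_right]
    have h1 : p.1 = 1 := by
      refine W_inj (g := a) hfp hnt fun i => ?_
      rw [hW]
      simpa using (T_θ θ hθ p.2⁻¹ i).conj a
    rw [h1, map_one, one_mul] at ha
    have h2 := θ_inj hfp hnt θ hθ _ _ ha
    exact SemidirectProduct.ext h1 h2
  have hsurj : Function.Surjective f := by
    let M : Subgroup (MulAut G) := (f.range.comap (QuotientGroup.mk' N)).map S.subtype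
    have hM : ∀ {ψ : MulAut G} (h : ψ ∈ S), (QuotientGroup.mk' N ⟨ψ, h⟩ ∈ f.range) → ψ ∈ M :=
      fun h h' => ⟨⟨_, h⟩, h', rfl⟩
    have hMF : ∀ p, F p ∈ M := fun p => hM (hFS p) ⟨p, rfl⟩
    have hMc : ∀ a, MulAut.conj a ∈ M := by
      intro a
      refine hM (hcS a) ?_
      have : (⟨MulAut.conj a, hcS a⟩ : S) ∈ N := (hN _).2 ⟨a, rfl⟩
      rw [QuotientGroup.mk'_apply, (QuotientGroup.eq_one_iff _).2 this]
      exact one_mem _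
    have hMθ : ∀ φ, θ φ ∈ M := fun φ => by
      have := hMF (SemidirectProduct.inr φ)
      simpa [hF] using this
    have hMΦ : ∀ ψ : MulAut G, (∀ i, T H ψ i 1) → ψ ∈ M := fun ψ h => by
      obtain ⟨φ, rfl⟩ := exists_θ hfp θ hθ ψ h
      exact hMθ φ
    have hMA1 : ∀ (j : Fin 3) (x : H j), A hfp (ne_succ j) x ∈ M := fun j x => by
      have := hMF (SemidirectProduct.inl (x : G))
      rw [hF] at this
      simpa [W_apply hfp x.2] using this
    have hMA : ∀ {j k : Fin 3} (h : j ≠ k) (x : H j), A hfp h x ∈ M := by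
      intro j k h x
      by_cases hk : k = j + 1
      · subst hk; exact hMA1 j x
      · have hk2 : ∀ m, m ≠ k → m ≠ j + 1 → m = j := by intro m; omega
        have h3 : MulAut.conj (x : G) * (A hfp h x * A hfp (ne_succ j) x) ∈ M := by
          refine hMΦ _ fun i => ?_
          by_cases hik : i = k
          · subst hik
            have e : A hfp h x (x : G) = x := A_ne hfp h h x x.2
            have h5 := (((T_one_one (H := H) i).A_same hfp h x).A_ne hfp (ne_succ j) hk x).conj x
            rw [one_mul] at h5
            simpa using h5
          · by_cases hij : i = j + 1
            · subst hij
              have e : A hfp h x (x : G) = x := A_ne hfp h h x x.2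
              have h5 := (((T_one_one (H := H) (j + 1)).A_ne hfp h hik x).A_same hfp
                (ne_succ j) x).conj x
              rw [one_mul, e] at h5
              simpa using h5
            · obtain rfl := hk2 i hik hij
              have h5 := (((T_one_one (H := H) i).A_ne hfp h h x).A_ne hfp
                (ne_succ i) hij x).conj x
              rw [one_mul] at h5
              simpa using h5.right (inv_mem x.2)
        exact (M.mul_mem_cancel_right (hMA1 j x)).1 ((M.mul_mem_cancel_left (hMc _)).1 h3)
    intro q
    obtain ⟨⟨ψ, hψ⟩, rfl⟩ := QuotientGroup.mk'_surjective N q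
    have hps := (hS ψ).1 hψ
    choose g hg using hps
    have : ψ ∈ M := mem_of_T hfp hnt M hMc hMA hMΦ _ ψ g hg rfl
    obtain ⟨⟨ψ', hψ'⟩, h1, h2⟩ := this
    have h2' : ψ' = ψ := h2
    subst h2'
    exact h1
  exact ⟨(MulEquiv.ofBijective f ⟨hinj, hsurj⟩).symm⟩
end
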